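/- Let γ, h : (0,1) → ℝ with γ(x) < 1 for all x ∈ (0,1), and let s ∈ ℝ satisfy s·h(x) < 1 − γ(x) for all x ∈ (0,1). Then the map T_{s,γ,h} restricts to a bijection from Ω_γ onto Ω_{γ+s·h}. -/

import Mathlib

/-- The domain `Ω_γ = {(x₁,x₂) : 0 < x₁ < 1, γ x₁ < x₂ < 1}`. -/
def OmegaDom (γ : ℝ → ℝ) : Set (ℝ × ℝ) :=
  {p : ℝ × ℝ | 0 < p.1 ∧ p.1 < 1 ∧ γ p.1 < p.2 ∧ p.2 < 1}

/-- The boundary perturbation map `T_{s,γ,h}(x₁,x₂) = (x₁, x₂ + s·(1−x₂)·h(x₁)/(1−γ(x₁)))`. -/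
noncomputable def perturbMap (s : ℝ) (γ h : ℝ → ℝ) : ℝ × ℝ → ℝ × ℝ :=
  fun p => (p.1, p.2 + s * (1 - p.2) * h p.1 / (1 - γ p.1))

theorem mapsTo_perturbMap {γ h : ℝ → ℝ} {s : ℝ}
    (hγ : ∀ x ∈ Set.Ioo (0:ℝ) 1, γ x < 1)
    (hsh : ∀ x ∈ Set.Ioo (0:ℝ) 1, s * h x < 1 - γ x) :
    Set.MapsTo (perturbMap s γ h) (OmegaDom γ) (OmegaDom (fun x => γ x + s * h x)) := by
  rintro ⟨x, y⟩ ⟨hx0, hx1, hy, hy1⟩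
  dsimp only at hx0 hx1 hy hy1
  have ha : 0 < 1 - γ x := sub_pos.2 (hγ x ⟨hx0, hx1⟩)
  have hc : 0 < 1 - γ x - s * h x := sub_pos.2 (hsh x ⟨hx0, hx1⟩)
  have lower : y + s * (1 - y) * h x / (1 - γ x) - (γ x + s * h x)
      = (y - γ x) * (1 - γ x - s * h x) / (1 - γ x) := by
    field_simp
    ring
  have upper : 1 - (y + s * (1 - y) * h x / (1 - γ x))
      = (1 - y) * (1 - γ x - s * h x) / (1 - γ x) := by
    field_simp
    ring
  refine ⟨hx0, hx1, sub_pos.1 ?_, sub_pos.1 ?_⟩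
  · exact lower ▸ div_pos (mul_pos (sub_pos.2 hy) hc) ha
  · exact upper ▸ div_pos (mul_pos (sub_pos.2 hy1) hc) ha

/-- Perturbing by `s` and then by `-s` over the perturbed boundary changes nothing. -/
theorem perturbMap_neg_perturbMap {γ h : ℝ → ℝ} {s : ℝ} {p : ℝ × ℝ}
    (ha : 1 - γ p.1 ≠ 0) (hc : 1 - (γ p.1 + s * h p.1) ≠ 0) :
    perturbMap (-s) (fun x => γ x + s * h x) h (perturbMap s γ h p) = p := by
  refine Prod.ext rfl ?_
  simp only [perturbMap]
  field_simp
  ring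

/-- If `γ < 1` and `s·h < 1 − γ` on `(0,1)`, then `T_{s,γ,h}` restricts to a bijection
from `Ω_γ` onto `Ω_{γ+s·h}`. -/
theorem perturbMap_bijOn (γ h : ℝ → ℝ) (s : ℝ)
    (hγ : ∀ x ∈ Set.Ioo (0:ℝ) 1, γ x < 1)
    (hsh : ∀ x ∈ Set.Ioo (0:ℝ) 1, s * h x < 1 - γ x) :
    Set.BijOn (perturbMap s γ h) (OmegaDom γ) (OmegaDom (fun x => γ x + s * h x)) := by
  have hγ' : ∀ x ∈ Set.Ioo (0:ℝ) 1, γ x + s * h x < 1 := fun x hx => by linarith [hsh x hx]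
  have hγ_eq : (fun x => γ x + s * h x + -s * h x) = γ := by
    ext x
    ring
  have maps_inv : Set.MapsTo (perturbMap (-s) (fun x => γ x + s * h x) h)
      (OmegaDom fun x => γ x + s * h x) (OmegaDom γ) := by
    have := mapsTo_perturbMap (s := -s) (h := h) hγ' fun x hx => by linarith [hγ x hx]
    rwa [hγ_eq] at this
  refine Set.InvOn.bijOn ⟨fun p hp => ?_, fun p hp => ?_⟩ (mapsTo_perturbMap hγ hsh) maps_inv
  · exact perturbMap_neg_perturbMap (sub_pos.2 (hγ _ ⟨hp.1, hp.2.1⟩)).ne'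
      (sub_pos.2 (hγ' _ ⟨hp.1, hp.2.1⟩)).ne'
  · have := perturbMap_neg_perturbMap (γ := fun x => γ x + s * h x) (h := h) (s := -s) (p := p)
      (sub_pos.2 (hγ' _ ⟨hp.1, hp.2.1⟩)).ne'
      (by linarith [hγ _ ⟨hp.1, hp.2.1⟩] : 0 < 1 - (γ p.1 + s * h p.1 + -s * h p.1)).ne'
    rwa [hγ_eq, neg_neg] at this
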